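/- At the surface of the slender body, the regularized and classical slender-body velocities differ by an O(1) logarithmic term: there exist constants C > 0 and ε₀ > 0, depending only on c_Γ and κ_max, such that for all 0 < ε < ε₀, 0 < δ < ε₀, every f ∈ C¹(ℝ/ℤ; ℝ³), and every point x = X(s) + ε e_ρ(s,θ) ∈ Γ_ε, |8π (u^δ(x) − u^SB(x)) + log(1 + δ²/ε²) (I + e_s(s) e_s(s)ᵀ) f(s)| ≤ C √(ε²+δ²) |log(ε²+δ²)| ‖f‖_{C¹}. In particular this O(1) discrepancy cannot be eliminated by any choice of δ proportional to ε. -/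

import Mathlib

open MeasureTheory

noncomputable section

local notation "⟪" x ", " y "⟫" => @inner ℝ _ _ x y

abbrev V3 : Type := EuclideanSpace ℝ (Fin 3)

/-- The `C⁰` (sup) norm of a function `ℝ/ℤ → ℝ³`. -/
def C0norm (f : ℝ → V3) : ℝ := ⨆ s : ℝ, ‖f s‖

/-- The `C¹` norm of a function `ℝ/ℤ → ℝ³`. -/
def C1norm (f : ℝ → V3) : ℝ := C0norm f + C0norm (deriv f)

/-- The radial unit vector `e_ρ(s,θ) = cos θ e_{n1}(s) + sin θ e_{n2}(s)`. -/
def ePerp (en1 en2 : ℝ → V3) (s θ : ℝ) : V3 :=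
  Real.cos θ • en1 s + Real.sin θ • en2 s

/-- `R(s, s̄, θ) = X(s) + ε e_ρ(s,θ) − X(s − s̄)`. -/
def Rvec (X en1 en2 : ℝ → V3) (ε s sb θ : ℝ) : V3 :=
  X s + ε • ePerp en1 en2 s θ - X (s - sb)

/-- The slender-body geometry hypotheses: `X : ℝ/ℤ → ℝ³` is a `C²` closed curve
parameterized by arclength, non-self-intersecting with constant `cΓ`, with curvature
bounded by `κmax`, together with a `C¹` orthonormal frame `(X', en1, en2)`. -/
structure SlenderGeom (cΓ κmax : ℝ) (X en1 en2 : ℝ → V3) : Prop where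
  smooth : ContDiff ℝ 2 X
  periodicX : ∀ s, X (s + 1) = X s
  arclength : ∀ s, ‖deriv X s‖ = 1
  no_self_intersect : ∀ s t : ℝ, |s - t| ≤ 1 / 2 → cΓ * |s - t| ≤ ‖X s - X t‖
  curvature_max : ∀ s, ‖deriv (deriv X) s‖ ≤ κmax
  en1_smooth : ContDiff ℝ 1 en1
  en2_smooth : ContDiff ℝ 1 en2
  en1_periodic : ∀ s, en1 (s + 1) = en1 s
  en2_periodic : ∀ s, en2 (s + 1) = en2 s
  en1_unit : ∀ s, ‖en1 s‖ = 1
  en2_unit : ∀ s, ‖en2 s‖ = 1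
  es_en1 : ∀ s, ⟪deriv X s, en1 s⟫ = 0
  es_en2 : ∀ s, ⟪deriv X s, en2 s⟫ = 0
  en1_en2 : ∀ s, ⟪en1 s, en2 s⟫ = 0

/-- The singular Stokeslet `S(y) v = v/|y| + (y·v) y/|y|³`. -/
def stokeslet (y v : V3) : V3 := ‖y‖⁻¹ • v + (‖y‖ ^ 3)⁻¹ • ⟪y, v⟫ • y

/-- The singular doublet `D(y) v = v/|y|³ − 3 (y·v) y/|y|⁵`. -/
def doubletK (y v : V3) : V3 := (‖y‖ ^ 3)⁻¹ • v - (3 * (‖y‖ ^ 5)⁻¹) • ⟪y, v⟫ • y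

/-- The regularized Stokeslet `S_δ(y) v`. -/
def stokesletReg (δ : ℝ) (y v : V3) : V3 :=
  ((‖y‖ ^ 2 + δ ^ 2) ^ ((1 : ℝ) / 2))⁻¹ • v
    + ((‖y‖ ^ 2 + δ ^ 2) ^ ((3 : ℝ) / 2))⁻¹ • (⟪y, v⟫ • y + δ ^ 2 • v)

/-- The regularized doublet `D_δ(y) v`. -/
def doubletReg (δ : ℝ) (y v : V3) : V3 :=
  ((‖y‖ ^ 2 + δ ^ 2) ^ ((3 : ℝ) / 2))⁻¹ • v
    - (3 * ((‖y‖ ^ 2 + δ ^ 2) ^ ((5 : ℝ) / 2))⁻¹) • (⟪y, v⟫ • y + δ ^ 2 • v)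

/-- The classical slender-body velocity `u^SB(x)` with doublet coefficient `ε²/2`. -/
def uSB (X f : ℝ → V3) (ε : ℝ) (x : V3) : V3 :=
  (8 * Real.pi)⁻¹ • ∫ t in (0:ℝ)..1,
    (stokeslet (x - X t) (f t) + (ε ^ 2 / 2) • doubletK (x - X t) (f t))

/-- The regularized slender-body velocity with doublet coefficient `β`. -/
def uReg (X f : ℝ → V3) (β δ : ℝ) (x : V3) : V3 :=
  (8 * Real.pi)⁻¹ • ∫ t in (0:ℝ)..1,
    (stokesletReg δ (x - X t) (f t) + β • doubletReg δ (x - X t) (f t))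

/-- The Keller–Rubinow classical centerline velocity `u^SB_C(X(s))`. -/
def uSBC (X f : ℝ → V3) (ε s : ℝ) : V3 :=
  (8 * Real.pi)⁻¹ •
    ((f s - (3 : ℝ) • ⟪deriv X s, f s⟫ • deriv X s
        - (2 * Real.log (Real.pi * ε / 4)) • (f s + ⟪deriv X s, f s⟫ • deriv X s))
      + ∫ t in (0:ℝ)..1,
          ((‖X s - X t‖⁻¹ • f t
              + (‖X s - X t‖ ^ 3)⁻¹ • ⟪X s - X t, f t⟫ • (X s - X t))
            - |Real.sin (Real.pi * (s - t)) / Real.pi|⁻¹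
                • (f s + ⟪deriv X s, f s⟫ • deriv X s)))

/-- The regularized pressure `p^δ(x)`. -/
def pReg (X f : ℝ → V3) (δ : ℝ) (x : V3) : ℝ :=
  (4 * Real.pi)⁻¹ * ∫ t in (0:ℝ)..1,
    (⟪x - X t, f t⟫ * ((‖x - X t‖ ^ 2 + δ ^ 2) ^ ((3 : ℝ) / 2))⁻¹
      + 3 * δ ^ 2 * ⟪x - X t, f t⟫ * (2 * (‖x - X t‖ ^ 2 + δ ^ 2) ^ ((5 : ℝ) / 2))⁻¹)

/-- The symmetric strain tensor `E(u) = (∇u + (∇u)ᵀ)/2` applied to the vector `n`. -/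
def strainApply (u : V3 → V3) (x n : V3) : V3 :=
  (2 : ℝ)⁻¹ • (fderiv ℝ u x n + gradient (fun y => ⟪u y, n⟫) x)

/-- The surface Jacobian `J_ε(s,θ) = ε(1 − ε(κ₁ cos θ + κ₂ sin θ))`. -/
def Jfac (X en1 en2 : ℝ → V3) (ε s θ : ℝ) : ℝ :=
  ε * (1 - ε * (⟪deriv (deriv X) s, en1 s⟫ * Real.cos θ
      + ⟪deriv (deriv X) s, en2 s⟫ * Real.sin θ))

/-- The regularized surface force density
`f^δ(s) = ∫_0^{2π} (2 E(u^δ) n − p^δ n) J_ε dθ`, with `n = −e_ρ`. -/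
def fReg (X en1 en2 f : ℝ → V3) (ε δ s : ℝ) : V3 :=
  ∫ θ in (0:ℝ)..(2 * Real.pi),
    Jfac X en1 en2 ε s θ •
      ((2 : ℝ) • strainApply (uReg X f ((ε ^ 2 + δ ^ 2) / 2) δ)
          (X s + ε • ePerp en1 en2 s θ) (-ePerp en1 en2 s θ)
        - pReg X f δ (X s + ε • ePerp en1 en2 s θ) • (-ePerp en1 en2 s θ))

/-- The vector field `d_n^δ[f](x)`. -/
def dReg (X f : ℝ → V3) (δ : ℝ) (n : ℕ) (x : V3) : V3 :=
  (8 * Real.pi)⁻¹ • ∫ t in (0:ℝ)..1,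
    (δ ^ 2 * ((‖x - X t‖ ^ 2 + δ ^ 2) ^ ((n : ℝ) / 2))⁻¹) • f t

/-- The scalar field `d_5^δ[f·R](x)`. -/
def dRegP (X f : ℝ → V3) (δ : ℝ) (x : V3) : ℝ :=
  (8 * Real.pi)⁻¹ * ∫ t in (0:ℝ)..1,
    δ ^ 2 * ⟪x - X t, f t⟫ * ((‖x - X t‖ ^ 2 + δ ^ 2) ^ ((5 : ℝ) / 2))⁻¹

/-- The extra force contribution
`F^δ(s) = ∫_0^{2π} (2E(d₃^δ[f])n − 3(ε²+δ²)E(d₅^δ[f])n − 3 d₅^δ[f·R] n) J_ε dθ`. -/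
def Fextra (X en1 en2 f : ℝ → V3) (ε δ s : ℝ) : V3 :=
  ∫ θ in (0:ℝ)..(2 * Real.pi),
    Jfac X en1 en2 ε s θ •
      ((2 : ℝ) • strainApply (dReg X f δ 3) (X s + ε • ePerp en1 en2 s θ)
          (-ePerp en1 en2 s θ)
        - (3 * (ε ^ 2 + δ ^ 2)) • strainApply (dReg X f δ 5)
            (X s + ε • ePerp en1 en2 s θ) (-ePerp en1 en2 s θ)
        - (3 * dRegP X f δ (X s + ε • ePerp en1 en2 s θ)) • (-ePerp en1 en2 s θ))

/-- Size and Lipschitz bounds on `[m, ∞)` modelled on `Q * x ^ (-p)`. -/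
def DecayBound (m Q p K : ℝ) (g : ℝ → ℝ) : Prop :=
  (∀ x, m ≤ x → |g x| ≤ K * Q * m ^ (-p)) ∧
    ∀ x y, m ≤ x → m ≤ y → |g x - g y| ≤ K * Q * m ^ (-p - 1) * |x - y|

theorem DecayBound.add {m Q p K L : ℝ} {g h : ℝ → ℝ} (hg : DecayBound m Q p K g)
    (hh : DecayBound m Q p L h) : DecayBound m Q p (K + L) (fun x => g x + h x) := by
  refine ⟨fun x hx => ?_, fun x y hx hy => ?_⟩
  · calc |g x + h x| ≤ |g x| + |h x| := abs_add_le _ _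
      _ ≤ K * Q * m ^ (-p) + L * Q * m ^ (-p) := add_le_add (hg.1 x hx) (hh.1 x hx)
      _ = _ := by ring
  · calc |g x + h x - (g y + h y)| = |(g x - g y) + (h x - h y)| := by ring_nf
      _ ≤ |g x - g y| + |h x - h y| := abs_add_le _ _
      _ ≤ K * Q * m ^ (-p - 1) * |x - y| + L * Q * m ^ (-p - 1) * |x - y| :=
        add_le_add (hg.2 x y hx hy) (hh.2 x y hx hy)
      _ = _ := by ring

theorem DecayBound.mono {m Q Q' p K K' : ℝ} {g : ℝ → ℝ} (hg : DecayBound m Q p K g) (hm : 0 < m)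
    (h : K * Q ≤ K' * Q') : DecayBound m Q' p K' g := by
  refine ⟨fun x hx => (hg.1 x hx).trans ?_, fun x y hx hy => (hg.2 x y hx hy).trans ?_⟩ <;> gcongr

theorem DecayBound.neg {m Q p K : ℝ} {g : ℝ → ℝ} (hg : DecayBound m Q p K g) :
    DecayBound m Q p K (fun x => -g x) := by
  refine ⟨fun x hx => by simpa using hg.1 x hx, fun x y hx hy => ?_⟩
  rw [abs_sub_comm, show -g y - -g x = g x - g y by ring]
  exact hg.2 x y hx hy

theorem rpow_neg_le_rpow_neg {m x p : ℝ} (hm : 0 < m) (hx : m ≤ x) (hp : 0 ≤ p) :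
    x ^ (-p) ≤ m ^ (-p) :=
  Real.rpow_le_rpow_of_nonpos hm hx (by linarith)

theorem abs_sub_le_of_abs_deriv_le_Ici {m B : ℝ} {g g' : ℝ → ℝ}
    (hg : ∀ x, m ≤ x → HasDerivAt g (g' x) x) (hB : ∀ x, m ≤ x → |g' x| ≤ B)
    {x y : ℝ} (hx : m ≤ x) (hy : m ≤ y) : |g x - g y| ≤ B * |x - y| :=
  (convex_Ici m).norm_image_sub_le_of_norm_hasDerivWithin_le
    (fun z hz => (hg z hz).hasDerivWithinAt) (fun z hz => hB z hz) hy hx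

theorem decayBound_mul_rpow {m Q p d j k : ℝ} (hm : 0 < m) (hd : 0 ≤ d) (hp : 0 ≤ p)
    (hj : 0 ≤ j) (hk : 0 ≤ k) (hkQ : k ≤ Q * (m + d) ^ j) :
    DecayBound m Q p (p + j + 1) (fun x => k * (x + d) ^ (-(p + j))) := by
  have hmd : 0 < m + d := by linarith
  have hQ : 0 ≤ Q := by
    have h1 : 0 < (m + d) ^ j := Real.rpow_pos_of_pos hmd j
    by_contra hneg
    nlinarith [mul_neg_of_neg_of_pos (not_le.1 hneg) h1]
  have key : ∀ q, 0 ≤ q → k * (m + d) ^ (-(q + j)) ≤ Q * m ^ (-q) := fun q hq => by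
    calc k * (m + d) ^ (-(q + j)) ≤ Q * (m + d) ^ j * (m + d) ^ (-(q + j)) := by gcongr
      _ = Q * (m + d) ^ (-q) := by
        rw [mul_assoc, ← Real.rpow_add hmd]; ring_nf
      _ ≤ Q * m ^ (-q) := by
        exact mul_le_mul_of_nonneg_left (rpow_neg_le_rpow_neg hm (by linarith) hq) hQ
  refine ⟨fun x hx => ?_, fun x y hx hy => ?_⟩
  · have hxd : 0 < x + d := by linarith
    rw [abs_of_nonneg (by positivity)]
    calc k * (x + d) ^ (-(p + j)) ≤ k * (m + d) ^ (-(p + j)) :=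
          mul_le_mul_of_nonneg_left
            (rpow_neg_le_rpow_neg hmd (by linarith) (by linarith)) hk
      _ ≤ 1 * (Q * m ^ (-p)) := by rw [one_mul]; exact key p hp
      _ ≤ (p + j + 1) * (Q * m ^ (-p)) := by gcongr; linarith
      _ = _ := by ring
  · refine abs_sub_le_of_abs_deriv_le_Ici
      (g := fun x => k * (x + d) ^ (-(p + j)))
      (g' := fun x => k * (-(p + j) * (x + d) ^ (-(p + j) - 1))) (fun z hz => ?_)
      (fun z hz => ?_) hx hy
    · have h1 : HasDerivAt (fun x : ℝ => x + d) 1 z := (hasDerivAt_id z).add_const d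
      have := (h1.rpow_const (p := -(p + j)) (Or.inl (by linarith))).const_mul k
      exact this.congr_deriv (by ring)
    · have hzd : 0 < z + d := by linarith
      have e : k * (-(p + j) * (z + d) ^ (-(p + j) - 1))
          = -((p + j) * (k * (z + d) ^ (-((p + 1) + j)))) := by
        rw [show -(p + j) - 1 = -((p + 1) + j) by ring]; ring
      rw [e, abs_neg, abs_of_nonneg (by positivity)]
      calc (p + j) * (k * (z + d) ^ (-((p + 1) + j)))
          ≤ (p + j) * (k * (m + d) ^ (-((p + 1) + j))) :=
            mul_le_mul_of_nonneg_left (mul_le_mul_of_nonneg_left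
              (rpow_neg_le_rpow_neg hmd (by linarith) (by linarith)) hk) (by linarith)
        _ ≤ (p + j) * (Q * m ^ (-(p + 1))) :=
          mul_le_mul_of_nonneg_left (key (p + 1) (by linarith)) (by linarith)
        _ ≤ (p + j + 1) * (Q * m ^ (-(p + 1))) :=
          mul_le_mul_of_nonneg_right (by linarith) (by positivity)
        _ = _ := by rw [show -(p + 1) = -p - 1 by ring]; ring

theorem abs_rpow_neg_add_sub_le {m Q p d x : ℝ} (hm : 0 < m) (hd : 0 ≤ d)
    (hdQ : d ≤ Q * (m + d)) (hp : 0 ≤ p) (hp3 : p ≤ 3) (hx : m ≤ x) :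
    |(x + d) ^ (-p) - x ^ (-p)| ≤ 3 * Q * m ^ (-p) := by
  have hmd : 0 < m + d := by linarith
  have hx0 : 0 < x := by linarith
  have hxd : 0 < x + d := by linarith
  have hQ : 0 ≤ Q := by
    by_contra hneg
    nlinarith [mul_neg_of_neg_of_pos (not_le.1 hneg) hmd]
  set u := x / (x + d) with hu
  have hu0 : 0 < u := by positivity
  have hu1 : u ≤ 1 := by rw [hu, div_le_one hxd]; linarith
  have huQ : 1 - u ≤ Q := by
    have : 1 - u = d / (x + d) := by rw [hu]; field_simp; ring
    rw [this, div_le_iff₀ hxd]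
    nlinarith
  have hup : u ^ (3 : ℕ) ≤ u ^ p := by
    rw [← Real.rpow_natCast]
    exact Real.rpow_le_rpow_of_exponent_ge hu0 hu1 (by exact_mod_cast hp3)
  have hup1 : u ^ p ≤ 1 := Real.rpow_le_one hu0.le hu1 hp
  have e : (x + d) ^ (-p) = x ^ (-p) * u ^ p := by
    rw [hu, Real.div_rpow hx0.le hxd.le, Real.rpow_neg hx0.le, Real.rpow_neg hxd.le]
    have : x ^ p ≠ 0 := (Real.rpow_pos_of_pos hx0 p).ne'
    field_simp
  have hpos : 0 < x ^ (-p) := Real.rpow_pos_of_pos hx0 _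
  have e2 : (x + d) ^ (-p) - x ^ (-p) = -(x ^ (-p) * (1 - u ^ p)) := by rw [e]; ring
  rw [e2, abs_neg, abs_of_nonneg (mul_nonneg hpos.le (by linarith))]
  have h3 : 1 - u ^ p ≤ 3 * Q := by
    nlinarith [mul_nonneg hu0.le (sq_nonneg (1 - u)), sq_nonneg (1 - u)]
  calc x ^ (-p) * (1 - u ^ p) ≤ m ^ (-p) * (3 * Q) := by
        apply mul_le_mul (rpow_neg_le_rpow_neg hm hx hp) h3 (by linarith)
        exact (Real.rpow_pos_of_pos hm _).le
    _ = _ := by ring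

theorem decayBound_rpow_add_sub {m Q p d : ℝ} (hm : 0 < m) (hd : 0 ≤ d)
    (hdQ : d ≤ Q * (m + d)) (hp : 0 ≤ p) (hp2 : p ≤ 2) :
    DecayBound m Q p (3 * (p + 1)) (fun x => (x + d) ^ (-p) - x ^ (-p)) := by
  have hmd : 0 < m + d := by linarith
  have hQ : 0 ≤ Q := by
    by_contra hneg
    nlinarith [mul_neg_of_neg_of_pos (not_le.1 hneg) hmd]
  refine ⟨fun x hx => ?_, fun x y hx hy => ?_⟩
  · refine (abs_rpow_neg_add_sub_le hm hd hdQ hp (by linarith) hx).trans ?_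
    gcongr
    linarith
  · refine abs_sub_le_of_abs_deriv_le_Ici
      (g := fun x => (x + d) ^ (-p) - x ^ (-p))
      (g' := fun x => -p * ((x + d) ^ (-(p + 1)) - x ^ (-(p + 1)))) (fun z hz => ?_)
      (fun z hz => ?_) hx hy
    · have h1 : HasDerivAt (fun x : ℝ => x + d) 1 z := (hasDerivAt_id z).add_const d
      have h2 := h1.rpow_const (p := -p) (Or.inl (by linarith))
      have h3 := (hasDerivAt_id z).rpow_const (p := -p)
        (Or.inl (show id z ≠ 0 by simp only [id]; linarith))
      refine (h2.sub h3).congr_deriv ?_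
      rw [show -(p + 1) = -p - 1 by ring]
      simp only [id]
      ring
    · rw [abs_mul, abs_neg, abs_of_nonneg hp]
      calc p * |(z + d) ^ (-(p + 1)) - z ^ (-(p + 1))| ≤ p * (3 * Q * m ^ (-(p + 1))) := by
            gcongr
            exact abs_rpow_neg_add_sub_le hm hd hdQ (by linarith) (by linarith) hz
        _ ≤ (p + 1) * (3 * Q * m ^ (-(p + 1))) := by gcongr; linarith
        _ = _ := by rw [show -(p + 1) = -p - 1 by ring]; ring

/-- Coefficient of the identity in the difference of the regularized and classical kernels, as a
function of the squared distance, with `E = ε ^ 2` and `d = δ ^ 2`. -/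
def idCoeff (E d x : ℝ) : ℝ :=
  ((x + d) ^ (-(1 / 2) : ℝ) - x ^ (-(1 / 2) : ℝ)) + (d + (E + d) / 2) * (x + d) ^ (-(3 / 2) : ℝ)
    + -(3 / 2 * (E + d) * d * (x + d) ^ (-(5 / 2) : ℝ)) + -(E / 2 * x ^ (-(3 / 2) : ℝ))

/-- Coefficient of `y yᵀ` in the difference of the regularized and classical kernels, as a
function of the squared distance, with `E = ε ^ 2` and `d = δ ^ 2`. -/
def dyadCoeff (E d x : ℝ) : ℝ :=
  ((x + d) ^ (-(3 / 2) : ℝ) - x ^ (-(3 / 2) : ℝ)) + -(3 / 2 * (E + d) * (x + d) ^ (-(5 / 2) : ℝ))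
    + 3 / 2 * E * x ^ (-(5 / 2) : ℝ)

theorem decayBound_idCoeff {m Q E d : ℝ} (hm : 0 < m) (hE : 0 ≤ E) (hd : 0 ≤ d)
    (hEQ : E ≤ Q * m) (hdQ : E + d ≤ Q * (m + d)) :
    DecayBound m Q (1 / 2) 100 (idCoeff E d) := by
  have hmd : 0 < m + d := by linarith
  have hQ : 0 ≤ Q := by
    by_contra hneg
    nlinarith [mul_neg_of_neg_of_pos (not_le.1 hneg) hmd]
  have h1 := decayBound_rpow_add_sub (p := 1 / 2) hm hd (by linarith : d ≤ Q * (m + d))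
    (by norm_num) (by norm_num)
  have h2 := decayBound_mul_rpow (p := 1 / 2) (d := d) (j := 1) (k := d + (E + d) / 2)
    (Q := 2 * Q) hm hd (by norm_num) (by norm_num) (by linarith) (by rw [Real.rpow_one]; linarith)
  have h3 := decayBound_mul_rpow (p := 1 / 2) (d := d) (j := 2) (k := 3 / 2 * (E + d) * d)
    (Q := 2 * Q) hm hd (by norm_num) (by norm_num) (by positivity) (by
      rw [Real.rpow_two]
      nlinarith [mul_le_mul hdQ (by linarith : d ≤ m + d) hd (by positivity), mul_nonneg hE hd])
  have h4 := decayBound_mul_rpow (p := 1 / 2) (d := 0) (j := 1) (k := E / 2)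
    (Q := Q) hm le_rfl (by norm_num) (by norm_num) (by linarith)
    (by rw [Real.rpow_one]; linarith)
  norm_num only [add_zero] at h2 h3 h4
  refine (((h1.add (h2.mono (Q' := Q) (K' := 10) hm (by linarith))).add
    (h3.mono (Q' := Q) (K' := 10) hm (by linarith)).neg).add h4.neg).mono hm ?_
  linarith

theorem decayBound_dyadCoeff {m Q E d : ℝ} (hm : 0 < m) (hE : 0 ≤ E) (hd : 0 ≤ d)
    (hEQ : E ≤ Q * m) (hdQ : E + d ≤ Q * (m + d)) :
    DecayBound m Q (3 / 2) 100 (dyadCoeff E d) := by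
  have hmd : 0 < m + d := by linarith
  have hQ : 0 ≤ Q := by
    by_contra hneg
    nlinarith [mul_neg_of_neg_of_pos (not_le.1 hneg) hmd]
  have h1 := decayBound_rpow_add_sub (p := 3 / 2) hm hd (by linarith : d ≤ Q * (m + d))
    (by norm_num) (by norm_num)
  have h2 := decayBound_mul_rpow (p := 3 / 2) (d := d) (j := 1) (k := 3 / 2 * (E + d))
    (Q := 2 * Q) hm hd (by norm_num) (by norm_num) (by linarith) (by rw [Real.rpow_one]; linarith)
  have h3 := decayBound_mul_rpow (p := 3 / 2) (d := 0) (j := 1) (k := 3 / 2 * E)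
    (Q := 2 * Q) hm le_rfl (by norm_num) (by norm_num) (by linarith)
    (by rw [Real.rpow_one]; linarith)
  norm_num only [add_zero] at h2 h3
  refine ((h1.add (h2.mono (Q' := Q) (K' := 10) hm (by linarith)).neg).add
    (h3.mono (Q' := Q) (K' := 10) hm (by linarith))).mono hm ?_
  linarith

theorem rpow_neg_half_odd {x : ℝ} (hx : 0 < x) :
    x ^ (-(1 / 2) : ℝ) = (√x)⁻¹ ∧ x ^ (-(3 / 2) : ℝ) = (√x ^ 3)⁻¹ ∧
      x ^ (-(5 / 2) : ℝ) = (√x ^ 5)⁻¹ := by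
  have h : ∀ n : ℕ, x ^ (-((n : ℝ) / 2)) = (√x ^ n)⁻¹ := fun n => by
    rw [Real.rpow_neg hx.le, Real.sqrt_eq_rpow, ← Real.rpow_natCast, ← Real.rpow_mul hx.le]
    ring_nf
  have h1 := h 1
  have h3 := h 3
  have h5 := h 5
  push_cast at h1 h3 h5
  rw [pow_one] at h1
  exact ⟨h1, h3, h5⟩

theorem sqrt_sq_add_pos {a : ℝ} (ha : 0 < a) (σ : ℝ) : 0 < √(σ ^ 2 + a) :=
  Real.sqrt_pos.2 (by positivity)

theorem sq_sqrt_sq_add {a : ℝ} (ha : 0 < a) (σ : ℝ) : √(σ ^ 2 + a) ^ 2 = σ ^ 2 + a :=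
  Real.sq_sqrt (by positivity)

theorem hasDerivAt_sqrt_sq_add {a : ℝ} (ha : 0 < a) (σ : ℝ) :
    HasDerivAt (fun σ => √(σ ^ 2 + a)) (σ / √(σ ^ 2 + a)) σ := by
  have h := ((hasDerivAt_pow 2 σ).add_const a).sqrt (by positivity)
  refine h.congr_deriv ?_
  have := sqrt_sq_add_pos ha σ
  field_simp
  norm_num

theorem add_sqrt_sq_add_pos {a : ℝ} (ha : 0 < a) (σ : ℝ) : 0 < σ + √(σ ^ 2 + a) := by
  have h := sq_sqrt_sq_add ha σ
  have := sqrt_sq_add_pos ha σ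
  by_contra hneg
  nlinarith

theorem hasDerivAt_log_add_sqrt {a : ℝ} (ha : 0 < a) (σ : ℝ) :
    HasDerivAt (fun σ => Real.log (σ + √(σ ^ 2 + a))) (√(σ ^ 2 + a))⁻¹ σ := by
  have h0 := add_sqrt_sq_add_pos ha σ
  have h1 := sqrt_sq_add_pos ha σ
  refine (((hasDerivAt_id σ).add (hasDerivAt_sqrt_sq_add ha σ)).log h0.ne').congr_deriv ?_
  simp only [Pi.add_apply, id]
  field_simp
  ring

theorem hasDerivAt_div_sqrt {a : ℝ} (ha : 0 < a) (σ : ℝ) :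
    HasDerivAt (fun σ => σ / √(σ ^ 2 + a)) (a * (√(σ ^ 2 + a) ^ 3)⁻¹) σ := by
  have h1 := sqrt_sq_add_pos ha σ
  have h2 := sq_sqrt_sq_add ha σ
  refine ((hasDerivAt_id σ).div (hasDerivAt_sqrt_sq_add ha σ) h1.ne').congr_deriv ?_
  simp only [id]
  field_simp
  rw [h2]
  ring

theorem hasDerivAt_div_sqrt_pow {a : ℝ} (ha : 0 < a) (σ : ℝ) :
    HasDerivAt (fun σ => σ / √(σ ^ 2 + a) ^ 3)
      (-2 * (√(σ ^ 2 + a) ^ 3)⁻¹ + 3 * a * (√(σ ^ 2 + a) ^ 5)⁻¹) σ := by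
  have h1 := sqrt_sq_add_pos ha σ
  have h2 := sq_sqrt_sq_add ha σ
  refine ((hasDerivAt_id σ).div ((hasDerivAt_sqrt_sq_add ha σ).pow 3)
    (pow_ne_zero 3 h1.ne')).congr_deriv ?_
  have ha' : a = √(σ ^ 2 + a) ^ 2 - σ ^ 2 := by rw [h2]; ring
  simp only [id, Pi.pow_apply]
  generalize √(σ ^ 2 + a) = R at *
  subst ha'
  field_simp
  ring

theorem hasDerivAt_cube_div_sqrt {a : ℝ} (ha : 0 < a) (σ : ℝ) :
    HasDerivAt (fun σ => σ ^ 3 / √(σ ^ 2 + a) ^ 3)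
      (3 * a * (σ ^ 2 * (√(σ ^ 2 + a) ^ 5)⁻¹)) σ := by
  have h1 := sqrt_sq_add_pos ha σ
  have h2 := sq_sqrt_sq_add ha σ
  refine ((hasDerivAt_pow 3 σ).div ((hasDerivAt_sqrt_sq_add ha σ).pow 3)
    (pow_ne_zero 3 h1.ne')).congr_deriv ?_
  have ha' : a = √(σ ^ 2 + a) ^ 2 - σ ^ 2 := by rw [h2]; ring
  simp only [Pi.pow_apply]
  generalize √(σ ^ 2 + a) = R at *
  subst ha'
  field_simp
  ring

theorem idCoeff_sq_add {E d : ℝ} (hE : 0 < E) (hd : 0 < d) (σ : ℝ) :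
    idCoeff E d (σ ^ 2 + E) = (√(σ ^ 2 + (E + d)))⁻¹ - (√(σ ^ 2 + E))⁻¹
      + (d + (E + d) / 2) * (√(σ ^ 2 + (E + d)) ^ 3)⁻¹
      - 3 / 2 * (E + d) * d * (√(σ ^ 2 + (E + d)) ^ 5)⁻¹ - E / 2 * (√(σ ^ 2 + E) ^ 3)⁻¹ := by
  obtain ⟨h1, h3, h5⟩ := rpow_neg_half_odd (show 0 < σ ^ 2 + (E + d) by positivity)
  obtain ⟨k1, k3, k5⟩ := rpow_neg_half_odd (show 0 < σ ^ 2 + E by positivity)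
  rw [idCoeff, add_assoc (σ ^ 2), h1, h3, h5, k1, k3]
  ring

theorem dyadCoeff_sq_add {E d : ℝ} (hE : 0 < E) (hd : 0 < d) (σ : ℝ) :
    dyadCoeff E d (σ ^ 2 + E) = (√(σ ^ 2 + (E + d)) ^ 3)⁻¹ - (√(σ ^ 2 + E) ^ 3)⁻¹
      - 3 / 2 * (E + d) * (√(σ ^ 2 + (E + d)) ^ 5)⁻¹
      + 3 / 2 * E * (√(σ ^ 2 + E) ^ 5)⁻¹ := by
  obtain ⟨h1, h3, h5⟩ := rpow_neg_half_odd (show 0 < σ ^ 2 + (E + d) by positivity)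
  obtain ⟨k1, k3, k5⟩ := rpow_neg_half_odd (show 0 < σ ^ 2 + E by positivity)
  rw [dyadCoeff, add_assoc (σ ^ 2), h3, h5, k3, k5]
  ring

theorem continuousOn_idCoeff (E : ℝ) {d : ℝ} (hd : 0 ≤ d) :
    ContinuousOn (idCoeff E d) (Set.Ioi 0) := by
  have h : ∀ p : ℝ, ContinuousOn (fun x : ℝ => x ^ p) (Set.Ioi 0) := fun p x hx =>
    (Real.continuousAt_rpow_const x p (Or.inl (ne_of_gt hx))).continuousWithinAt
  have h' : ∀ p : ℝ, ContinuousOn (fun x : ℝ => (x + d) ^ p) (Set.Ioi 0) := fun p =>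
    (h p).comp (by fun_prop) (fun x hx => add_pos_of_pos_of_nonneg hx hd)
  exact ((((h' _).sub (h _)).add ((h' _).const_mul _)).add ((h' _).const_mul _).neg).add
    ((h _).const_mul _).neg

theorem continuousOn_dyadCoeff (E : ℝ) {d : ℝ} (hd : 0 ≤ d) :
    ContinuousOn (dyadCoeff E d) (Set.Ioi 0) := by
  have h : ∀ p : ℝ, ContinuousOn (fun x : ℝ => x ^ p) (Set.Ioi 0) := fun p x hx =>
    (Real.continuousAt_rpow_const x p (Or.inl (ne_of_gt hx))).continuousWithinAt
  have h' : ∀ p : ℝ, ContinuousOn (fun x : ℝ => (x + d) ^ p) (Set.Ioi 0) := fun p =>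
    (h p).comp (by fun_prop) (fun x hx => add_pos_of_pos_of_nonneg hx hd)
  exact (((h' _).sub (h _)).add ((h' _).const_mul _).neg).add ((h _).const_mul _)

theorem continuous_idCoeff_sq_add {E d : ℝ} (hE : 0 < E) (hd : 0 ≤ d) :
    Continuous fun σ : ℝ => idCoeff E d (σ ^ 2 + E) :=
  (continuousOn_idCoeff E hd).comp_continuous (by fun_prop)
    (fun σ => show 0 < σ ^ 2 + E by positivity)

theorem continuous_dyadCoeff_sq_add {E d : ℝ} (hE : 0 < E) (hd : 0 ≤ d) :
    Continuous fun σ : ℝ => dyadCoeff E d (σ ^ 2 + E) :=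
  (continuousOn_dyadCoeff E hd).comp_continuous (by fun_prop)
    (fun σ => show 0 < σ ^ 2 + E by positivity)

theorem integral_dyadCoeff_mul_id {E d : ℝ} :
    ∫ σ in (-(1 / 2) : ℝ)..1 / 2, dyadCoeff E d (σ ^ 2 + E) * σ = 0 := by
  have h := intervalIntegral.integral_comp_neg (a := -(1 / 2)) (b := 1 / 2)
    (fun σ : ℝ => dyadCoeff E d (σ ^ 2 + E) * σ)
  simp only [neg_sq, mul_neg, intervalIntegral.integral_neg, neg_neg] at h
  linarith

theorem log_half_add_sub_log {a : ℝ} (ha : 0 < a) :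
    Real.log (1 / 2 + √((1 / 2) ^ 2 + a)) - Real.log (-(1 / 2) + √((-(1 / 2)) ^ 2 + a))
      = 2 * Real.log (1 / 2 + √((1 / 2) ^ 2 + a)) - Real.log a := by
  have h1 := add_sqrt_sq_add_pos ha (1 / 2)
  have h2 := add_sqrt_sq_add_pos ha (-(1 / 2))
  have h3 := sq_sqrt_sq_add ha (1 / 2)
  have : Real.log a = Real.log (1 / 2 + √((1 / 2) ^ 2 + a))
      + Real.log (-(1 / 2) + √((-(1 / 2)) ^ 2 + a)) := by
    rw [← Real.log_mul h1.ne' h2.ne']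
    congr 1
    rw [neg_sq]
    linear_combination -h3
  linarith

/-- Comparison of the endpoint values of the antiderivatives for two regularization lengths. -/
theorem sqrt_quarter_estimates {E d : ℝ} (hE : 0 < E) (hd : 0 < d) :
    1 / 2 ≤ √((1 / 2) ^ 2 + E) ∧ √((1 / 2) ^ 2 + E) ≤ √((1 / 2) ^ 2 + (E + d)) ∧
      √((1 / 2) ^ 2 + (E + d)) - √((1 / 2) ^ 2 + E) ≤ d := by
  have h1 : (1 / 2 : ℝ) ≤ √((1 / 2) ^ 2 + E) := Real.le_sqrt_of_sq_le (by linarith)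
  have h2 : √((1 / 2) ^ 2 + E) ≤ √((1 / 2) ^ 2 + (E + d)) := Real.sqrt_le_sqrt (by linarith)
  have h3 := sq_sqrt_sq_add hE (1 / 2)
  have h4 := sq_sqrt_sq_add (add_pos hE hd) (1 / 2)
  refine ⟨h1, h2, ?_⟩
  nlinarith

theorem log_half_add_sqrt_sub_le {E d : ℝ} (hE : 0 < E) (hd : 0 < d) :
    |2 * Real.log (1 / 2 + √((1 / 2) ^ 2 + (E + d))) - 2 * Real.log (1 / 2 + √((1 / 2) ^ 2 + E))|
      ≤ 2 * d := by
  obtain ⟨h1, h2, h3⟩ := sqrt_quarter_estimates hE hd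
  generalize √((1 / 2) ^ 2 + (E + d)) = R at *
  generalize √((1 / 2) ^ 2 + E) = S at *
  have hS : 0 < 1 / 2 + S := by linarith
  have hR : 0 < 1 / 2 + R := by linarith
  rw [← mul_sub, ← Real.log_div hR.ne' hS.ne', abs_of_nonneg]
  · have := Real.log_le_sub_one_of_pos (div_pos hR hS)
    have h4 : (1 / 2 + R) / (1 / 2 + S) - 1 ≤ d := by
      rw [div_sub_one hS.ne', div_le_iff₀ hS]
      nlinarith
    linarith
  · have : 0 ≤ Real.log ((1 / 2 + R) / (1 / 2 + S)) :=
      Real.log_nonneg ((one_le_div hS).2 (by linarith))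
    linarith

theorem inv_sub_inv_bounds {R S d : ℝ} (hS : 1 / 2 ≤ S) (hSR : S ≤ R) (hd : R - S ≤ d) :
    0 ≤ S⁻¹ - R⁻¹ ∧ S⁻¹ - R⁻¹ ≤ 4 * d ∧ 0 ≤ (S ^ 3)⁻¹ - (R ^ 3)⁻¹ ∧
      (S ^ 3)⁻¹ - (R ^ 3)⁻¹ ≤ 48 * d ∧ 0 ≤ (R ^ 3)⁻¹ ∧ (R ^ 3)⁻¹ ≤ 8 ∧ (S ^ 3)⁻¹ ≤ 8 := by
  have hS0 : 0 < S := by linarith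
  have hR0 : 0 < R := by linarith
  have hs : S⁻¹ ≤ 2 := by
    rw [inv_le_comm₀ hS0 (by norm_num)]; linarith
  have hrs : R⁻¹ ≤ S⁻¹ := inv_anti₀ hS0 hSR
  have hr0 : 0 < R⁻¹ := by positivity
  have hdiff : S⁻¹ - R⁻¹ = (R - S) * (S⁻¹ * R⁻¹) := by field_simp
  have h2 : S⁻¹ * R⁻¹ ≤ 4 := by nlinarith
  have h4 : S⁻¹ - R⁻¹ ≤ 4 * d := by
    rw [hdiff]
    nlinarith [mul_nonneg (sub_nonneg.2 hSR) (sub_nonneg.2 h2)]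
  rw [← inv_pow, ← inv_pow]
  generalize S⁻¹ = s at *
  generalize R⁻¹ = r at *
  have hcube : s ^ 3 - r ^ 3 = (s - r) * (s ^ 2 + s * r + r ^ 2) := by ring
  have h5 : s ^ 2 + s * r + r ^ 2 ≤ 12 := by nlinarith
  have h6 : 0 ≤ s ^ 2 + s * r + r ^ 2 := by nlinarith
  have h8 : s ^ 3 ≤ 8 := by
    have := pow_le_pow_left₀ (by linarith : 0 ≤ s) hs 3
    norm_num at this ⊢
    exact this
  have h7 : 0 ≤ s ^ 3 - r ^ 3 := by rw [hcube]; exact mul_nonneg (by linarith) h6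
  refine ⟨by linarith, h4, h7, ?_, by positivity, by linarith, h8⟩
  rw [hcube]
  nlinarith [mul_nonneg (sub_nonneg.2 hrs) (sub_nonneg.2 h5)]

theorem abs_integral_idCoeff_add_log_le {E d : ℝ} (hE : 0 < E) (hd : 0 < d) :
    |(∫ σ in (-(1 / 2) : ℝ)..1 / 2, idCoeff E d (σ ^ 2 + E)) + Real.log (1 + d / E)|
      ≤ 8 * d := by
  have hEd : 0 < E + d := by linarith
  have hderiv : ∀ σ : ℝ, HasDerivAt (fun σ => Real.log (σ + √(σ ^ 2 + (E + d)))
      - Real.log (σ + √(σ ^ 2 + E)) + 1 / 2 * (σ / √(σ ^ 2 + (E + d)))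
      - 1 / 2 * (σ / √(σ ^ 2 + E)) - d / 2 * (σ / √(σ ^ 2 + (E + d)) ^ 3))
      (idCoeff E d (σ ^ 2 + E)) σ := fun σ => by
    refine (((((hasDerivAt_log_add_sqrt hEd σ).sub (hasDerivAt_log_add_sqrt hE σ)).add
      ((hasDerivAt_div_sqrt hEd σ).const_mul (1 / 2))).sub
      ((hasDerivAt_div_sqrt hE σ).const_mul (1 / 2))).sub
      ((hasDerivAt_div_sqrt_pow hEd σ).const_mul (d / 2))).congr_deriv ?_
    rw [idCoeff_sq_add hE hd]
    ring
  rw [intervalIntegral.integral_eq_sub_of_hasDerivAt (fun σ _ => hderiv σ)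
    ((continuous_idCoeff_sq_add hE hd.le).intervalIntegrable _ _)]
  have hl1 := log_half_add_sub_log hEd
  have hl2 := log_half_add_sub_log hE
  have hl3 := log_half_add_sqrt_sub_le hE hd
  have hl4 : Real.log (1 + d / E) = Real.log (E + d) - Real.log E := by
    rw [← Real.log_div hEd.ne' hE.ne']; congr 1; field_simp
  obtain ⟨h1, h2, h3⟩ := sqrt_quarter_estimates hE hd
  obtain ⟨b1, b2, b3, b4, b5, b6, b7⟩ := inv_sub_inv_bounds h1 h2 h3
  rw [neg_sq] at *
  simp only [div_eq_mul_inv _ (√_), div_eq_mul_inv _ (√_ ^ 3)]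
  generalize √((1 / 2) ^ 2 + (E + d)) = R at *
  generalize √((1 / 2) ^ 2 + E) = S at *
  have b8 : d * (R ^ 3)⁻¹ ≤ 8 * d := by nlinarith
  have b9 : 0 ≤ d * (R ^ 3)⁻¹ := by positivity
  rw [abs_le] at hl3 ⊢
  constructor <;> linarith [hl3.1, hl3.2]

theorem abs_integral_dyadCoeff_le {E d : ℝ} (hE : 0 < E) (hd : 0 < d) :
    |∫ σ in (-(1 / 2) : ℝ)..1 / 2, dyadCoeff E d (σ ^ 2 + E)| ≤ 4 := by
  have hEd : 0 < E + d := by linarith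
  have hderiv : ∀ σ : ℝ, HasDerivAt (fun σ => 1 / 2 * (σ / √(σ ^ 2 + E) ^ 3)
      - 1 / 2 * (σ / √(σ ^ 2 + (E + d)) ^ 3)) (dyadCoeff E d (σ ^ 2 + E)) σ := fun σ => by
    refine (((hasDerivAt_div_sqrt_pow hE σ).const_mul (1 / 2)).sub
      ((hasDerivAt_div_sqrt_pow hEd σ).const_mul (1 / 2))).congr_deriv ?_
    rw [dyadCoeff_sq_add hE hd]
    ring
  rw [intervalIntegral.integral_eq_sub_of_hasDerivAt (fun σ _ => hderiv σ)
    ((continuous_dyadCoeff_sq_add hE hd.le).intervalIntegrable _ _)]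
  obtain ⟨h1, h2, h3⟩ := sqrt_quarter_estimates hE hd
  obtain ⟨b1, b2, b3, b4, b5, b6, b7⟩ := inv_sub_inv_bounds h1 h2 h3
  rw [neg_sq] at *
  simp only [div_eq_mul_inv _ (√_ ^ 3)]
  rw [abs_le]
  constructor <;> linarith

theorem abs_integral_dyadCoeff_mul_sq_add_log_le {E d : ℝ} (hE : 0 < E) (hd : 0 < d) :
    |(∫ σ in (-(1 / 2) : ℝ)..1 / 2, dyadCoeff E d (σ ^ 2 + E) * σ ^ 2) + Real.log (1 + d / E)|
      ≤ 12 * d := by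
  have hEd : 0 < E + d := by linarith
  have hderiv : ∀ σ : ℝ, HasDerivAt (fun σ => Real.log (σ + √(σ ^ 2 + (E + d)))
      - Real.log (σ + √(σ ^ 2 + E)) - σ / √(σ ^ 2 + (E + d)) + σ / √(σ ^ 2 + E)
      - 1 / 2 * (σ ^ 3 / √(σ ^ 2 + (E + d)) ^ 3) + 1 / 2 * (σ ^ 3 / √(σ ^ 2 + E) ^ 3))
      (dyadCoeff E d (σ ^ 2 + E) * σ ^ 2) σ := fun σ => by
    refine ((((((hasDerivAt_log_add_sqrt hEd σ).sub (hasDerivAt_log_add_sqrt hE σ)).sub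
      (hasDerivAt_div_sqrt hEd σ)).add (hasDerivAt_div_sqrt hE σ)).sub
      ((hasDerivAt_cube_div_sqrt hEd σ).const_mul (1 / 2))).add
      ((hasDerivAt_cube_div_sqrt hE σ).const_mul (1 / 2))).congr_deriv ?_
    rw [dyadCoeff_sq_add hE hd]
    have e1 : ∀ a : ℝ, 0 < a →
        (√(σ ^ 2 + a))⁻¹ = a * (√(σ ^ 2 + a) ^ 3)⁻¹ + σ ^ 2 * (√(σ ^ 2 + a) ^ 3)⁻¹ :=
      fun a ha => by
        have h1 := sqrt_sq_add_pos ha σ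
        have h2 := sq_sqrt_sq_add ha σ
        field_simp
        rw [h2]
        ring
    rw [e1 _ hEd, e1 _ hE]
    ring
  rw [intervalIntegral.integral_eq_sub_of_hasDerivAt (fun σ _ => hderiv σ)
    (((continuous_dyadCoeff_sq_add hE hd.le).mul (continuous_pow 2)).intervalIntegrable _ _)]
  have hl1 := log_half_add_sub_log hEd
  have hl2 := log_half_add_sub_log hE
  have hl3 := log_half_add_sqrt_sub_le hE hd
  have hl4 : Real.log (1 + d / E) = Real.log (E + d) - Real.log E := by
    rw [← Real.log_div hEd.ne' hE.ne']; congr 1; field_simp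
  obtain ⟨h1, h2, h3⟩ := sqrt_quarter_estimates hE hd
  obtain ⟨b1, b2, b3, b4, b5, b6, b7⟩ := inv_sub_inv_bounds h1 h2 h3
  rw [neg_sq] at *
  simp only [div_eq_mul_inv _ (√_), div_eq_mul_inv _ (√_ ^ 3)]
  generalize √((1 / 2) ^ 2 + (E + d)) = R at *
  generalize √((1 / 2) ^ 2 + E) = S at *
  rw [abs_le] at hl3 ⊢
  constructor <;> linarith [hl3.1, hl3.2]

/-- Difference of the regularized and classical slender-body kernels, with `E = ε ^ 2` and
`d = δ ^ 2`. -/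
def kernelDiff (E d : ℝ) (y v : V3) : V3 :=
  idCoeff E d (‖y‖ ^ 2) • v + dyadCoeff E d (‖y‖ ^ 2) • ⟪y, v⟫ • y

theorem reg_sub_classical_eq_kernelDiff {ε δ : ℝ} {y : V3} (hy : y ≠ 0) (v : V3) :
    (stokesletReg δ y v + ((ε ^ 2 + δ ^ 2) / 2) • doubletReg δ y v)
        - (stokeslet y v + (ε ^ 2 / 2) • doubletK y v)
      = kernelDiff (ε ^ 2) (δ ^ 2) y v := by
  have hy0 : 0 < ‖y‖ := norm_pos_iff.2 hy
  obtain ⟨k1, k3, k5⟩ := rpow_neg_half_odd (show 0 < ‖y‖ ^ 2 by positivity)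
  rw [Real.sqrt_sq hy0.le] at k1 k3 k5
  have hpos : 0 ≤ ‖y‖ ^ 2 + δ ^ 2 := by positivity
  rw [kernelDiff, idCoeff, dyadCoeff, k1, k3, k5, stokesletReg, doubletReg, stokeslet, doubletK,
    Real.rpow_neg hpos, Real.rpow_neg hpos, Real.rpow_neg hpos]
  module

theorem abs_norm_sq_sub_norm_sq_le {y y₀ : V3} {r b : ℝ} (hr : 0 ≤ r) (hy : ‖y‖ ≤ 2 * r)
    (hy₀ : ‖y₀‖ ≤ 2 * r) (hb : ‖y - y₀‖ ≤ b) : |‖y‖ ^ 2 - ‖y₀‖ ^ 2| ≤ 4 * r * b := by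
  rw [sq_sub_sq, abs_mul, abs_of_nonneg (by positivity)]
  exact mul_le_mul (by linarith) ((abs_norm_sub_norm_le _ _).trans hb) (abs_nonneg _)
    (by positivity)

theorem norm_dyad_sub_dyad_le {y y₀ v : V3} {r b F : ℝ} (hr : 0 ≤ r) (hy : ‖y‖ ≤ 2 * r)
    (hy₀ : ‖y₀‖ ≤ 2 * r) (hb : ‖y - y₀‖ ≤ b) (hv : ‖v‖ ≤ F) :
    ‖⟪y, v⟫ • y - ⟪y₀, v⟫ • y₀‖ ≤ 4 * r * b * F := by
  have hb0 : 0 ≤ b := (norm_nonneg _).trans hb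
  have hF : 0 ≤ F := (norm_nonneg _).trans hv
  have e : ⟪y, v⟫ • y - ⟪y₀, v⟫ • y₀ = ⟪y, v⟫ • (y - y₀) + ⟪y - y₀, v⟫ • y₀ := by
    rw [inner_sub_left]; module
  rw [e]
  calc _ ≤ ‖⟪y, v⟫ • (y - y₀)‖ + ‖⟪y - y₀, v⟫ • y₀‖ := norm_add_le _ _
    _ ≤ (2 * r * F) * b + (b * F) * (2 * r) := by
      rw [norm_smul, norm_smul]
      have i1 : ‖⟪y, v⟫‖ ≤ 2 * r * F :=
        (norm_inner_le_norm _ _).trans (mul_le_mul hy hv (norm_nonneg _) (by positivity))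
      have i2 : ‖⟪y - y₀, v⟫‖ ≤ b * F :=
        (norm_inner_le_norm _ _).trans (mul_le_mul hb hv (norm_nonneg _) (by positivity))
      gcongr
    _ = _ := by ring

theorem norm_dyad_le {y v : V3} {r G : ℝ} (hr : 0 ≤ r) (hy : ‖y‖ ≤ 2 * r) (hv : ‖v‖ ≤ G) :
    ‖⟪y, v⟫ • y‖ ≤ 4 * r ^ 2 * G := by
  have hG : 0 ≤ G := (norm_nonneg _).trans hv
  rw [norm_smul]
  calc ‖⟪y, v⟫‖ * ‖y‖ ≤ (‖y‖ * ‖v‖) * ‖y‖ := by gcongr; exact norm_inner_le_norm _ _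
    _ ≤ (2 * r * G) * (2 * r) := by gcongr
    _ = _ := by ring

/-- The constant in `norm_kernelDiff_sub_le`. -/
def kernelConst (c κ : ℝ) : ℝ :=
  100 * c⁻¹ + (800 * κ + 400) * c⁻¹ ^ 3 + 1600 * κ * c⁻¹ ^ 5

theorem norm_kernelDiff_sub_le {E d Q c r κ F : ℝ} {y y₀ v v₀ : V3} (hE : 0 ≤ E) (hd : 0 ≤ d)
    (hc : 0 < c) (hr : 0 < r) (hκ : 0 ≤ κ)
    (hEQ : E ≤ Q * (c * r) ^ 2) (hdQ : E + d ≤ Q * ((c * r) ^ 2 + d))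
    (hyl : c * r ≤ ‖y‖) (hyl₀ : c * r ≤ ‖y₀‖) (hy : ‖y‖ ≤ 2 * r) (hy₀ : ‖y₀‖ ≤ 2 * r)
    (hyy : ‖y - y₀‖ ≤ κ * r ^ 2) (hvv : ‖v - v₀‖ ≤ F * r) (hv₀ : ‖v₀‖ ≤ F) :
    ‖kernelDiff E d y v - kernelDiff E d y₀ v₀‖ ≤ kernelConst c κ * Q * F := by
  have hF : 0 ≤ F := (norm_nonneg _).trans hv₀
  have hcr : 0 < c * r := by positivity
  have hm : 0 < (c * r) ^ 2 := by positivity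
  have hQ : 0 ≤ Q := by
    by_contra hneg
    nlinarith [mul_neg_of_neg_of_pos (not_le.1 hneg) hm]
  obtain ⟨k1, k3, k5⟩ := rpow_neg_half_odd hm
  rw [Real.sqrt_sq hcr.le] at k1 k3 k5
  obtain ⟨a1, a2⟩ := decayBound_idCoeff hm hE hd hEQ hdQ
  obtain ⟨b1, b2⟩ := decayBound_dyadCoeff hm hE hd hEQ hdQ
  rw [show (-(1 / 2) - 1 : ℝ) = -(3 / 2) by norm_num, k3] at a2
  rw [show (-(3 / 2) - 1 : ℝ) = -(5 / 2) by norm_num, k5] at b2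
  rw [k1] at a1
  rw [k3] at b1
  have hx : (c * r) ^ 2 ≤ ‖y‖ ^ 2 := by gcongr
  have hx₀ : (c * r) ^ 2 ≤ ‖y₀‖ ^ 2 := by gcongr
  have hxx := abs_norm_sq_sub_norm_sq_le hr.le hy hy₀ hyy
  have e : kernelDiff E d y v - kernelDiff E d y₀ v₀
      = idCoeff E d (‖y‖ ^ 2) • (v - v₀)
        + (idCoeff E d (‖y‖ ^ 2) - idCoeff E d (‖y₀‖ ^ 2)) • v₀
        + dyadCoeff E d (‖y‖ ^ 2) • (⟪y, v - v₀⟫ • y)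
        + (dyadCoeff E d (‖y‖ ^ 2) - dyadCoeff E d (‖y₀‖ ^ 2)) • (⟪y, v₀⟫ • y)
        + dyadCoeff E d (‖y₀‖ ^ 2) • (⟪y, v₀⟫ • y - ⟪y₀, v₀⟫ • y₀) := by
    rw [kernelDiff, kernelDiff, inner_sub_right]; module
  have t1 : ‖idCoeff E d (‖y‖ ^ 2) • (v - v₀)‖ ≤ 100 * Q * (c * r)⁻¹ * (F * r) := by
    rw [norm_smul]
    exact mul_le_mul (a1 _ hx) hvv (norm_nonneg _) (by positivity)
  have t2 : ‖(idCoeff E d (‖y‖ ^ 2) - idCoeff E d (‖y₀‖ ^ 2)) • v₀‖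
      ≤ 100 * Q * ((c * r) ^ 3)⁻¹ * (4 * r * (κ * r ^ 2)) * F := by
    rw [norm_smul]
    exact mul_le_mul ((a2 _ _ hx hx₀).trans (by gcongr)) hv₀ (norm_nonneg _) (by positivity)
  have t3 : ‖dyadCoeff E d (‖y‖ ^ 2) • (⟪y, v - v₀⟫ • y)‖
      ≤ 100 * Q * ((c * r) ^ 3)⁻¹ * (4 * r ^ 2 * (F * r)) := by
    rw [norm_smul]
    exact mul_le_mul (b1 _ hx) (norm_dyad_le hr.le hy hvv) (norm_nonneg _) (by positivity)
  have t4 : ‖(dyadCoeff E d (‖y‖ ^ 2) - dyadCoeff E d (‖y₀‖ ^ 2)) • (⟪y, v₀⟫ • y)‖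
      ≤ 100 * Q * ((c * r) ^ 5)⁻¹ * (4 * r * (κ * r ^ 2)) * (4 * r ^ 2 * F) := by
    rw [norm_smul]
    exact mul_le_mul ((b2 _ _ hx hx₀).trans (by gcongr)) (norm_dyad_le hr.le hy hv₀)
      (norm_nonneg _) (by positivity)
  have t5 : ‖dyadCoeff E d (‖y₀‖ ^ 2) • (⟪y, v₀⟫ • y - ⟪y₀, v₀⟫ • y₀)‖
      ≤ 100 * Q * ((c * r) ^ 3)⁻¹ * (4 * r * (κ * r ^ 2) * F) := by
    rw [norm_smul]
    exact mul_le_mul (b1 _ hx₀) (norm_dyad_sub_dyad_le hr.le hy hy₀ hyy hv₀)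
      (norm_nonneg _) (by positivity)
  rw [e]
  refine (norm_add_le_of_le (norm_add_le_of_le (norm_add_le_of_le (norm_add_le_of_le
    t1 t2) t3) t4) t5).trans (le_of_eq ?_)
  rw [kernelConst]
  field_simp
  ring

theorem inner_line_eq (ε σ : ℝ) {e t : V3} (he : ‖e‖ = 1) (ht : ‖t‖ = 1) (het : ⟪t, e⟫ = 0) :
    ‖ε • e + σ • t‖ ^ 2 = σ ^ 2 + ε ^ 2 := by
  rw [norm_add_sq_real, norm_smul, norm_smul, real_inner_smul_left, real_inner_smul_right,
    real_inner_comm, het, he, ht]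
  simp only [Real.norm_eq_abs, mul_one, sq_abs]
  ring

theorem continuous_kernelDiff_line {ε : ℝ} (hε : 0 < ε) {d : ℝ} (hd : 0 ≤ d) {e t : V3}
    (he : ‖e‖ = 1) (ht : ‖t‖ = 1) (het : ⟪t, e⟫ = 0) (v : V3) :
    Continuous fun σ : ℝ => kernelDiff (ε ^ 2) d (ε • e + σ • t) v := by
  simp only [kernelDiff, inner_line_eq ε _ he ht het]
  have := continuous_idCoeff_sq_add (pow_pos hε 2) hd
  have := continuous_dyadCoeff_sq_add (pow_pos hε 2) hd
  fun_prop

/-- Leading-order discrepancy for a straight filament of unit length with constant force. -/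
theorem norm_integral_kernelDiff_line_add_log_le {ε d : ℝ} (hε : 0 < ε) (hd : 0 < d) {e t : V3}
    (he : ‖e‖ = 1) (ht : ‖t‖ = 1) (het : ⟪t, e⟫ = 0) (v : V3) :
    ‖(∫ σ in (-(1 / 2) : ℝ)..1 / 2, kernelDiff (ε ^ 2) d (ε • e + σ • t) v)
        + Real.log (1 + d / ε ^ 2) • (v + ⟪t, v⟫ • t)‖ ≤ 20 * (ε ^ 2 + d) * ‖v‖ := by
  have hE : 0 < ε ^ 2 := by positivity
  have cA := continuous_idCoeff_sq_add hE hd.le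
  have cB := continuous_dyadCoeff_sq_add hE hd.le
  have hsplit : (∫ σ in (-(1 / 2) : ℝ)..1 / 2, kernelDiff (ε ^ 2) d (ε • e + σ • t) v)
      = (∫ σ in (-(1 / 2) : ℝ)..1 / 2, idCoeff (ε ^ 2) d (σ ^ 2 + ε ^ 2)) • v
        + (∫ σ in (-(1 / 2) : ℝ)..1 / 2, dyadCoeff (ε ^ 2) d (σ ^ 2 + ε ^ 2)) •
          (ε ^ 2 * ⟪e, v⟫) • e
        + (∫ σ in (-(1 / 2) : ℝ)..1 / 2, dyadCoeff (ε ^ 2) d (σ ^ 2 + ε ^ 2) * σ) •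
          ε • (⟪e, v⟫ • t + ⟪t, v⟫ • e)
        + (∫ σ in (-(1 / 2) : ℝ)..1 / 2, dyadCoeff (ε ^ 2) d (σ ^ 2 + ε ^ 2) * σ ^ 2) •
          ⟪t, v⟫ • t := by
    simp only [← intervalIntegral.integral_smul_const]
    rw [← intervalIntegral.integral_add, ← intervalIntegral.integral_add,
      ← intervalIntegral.integral_add]
    · refine intervalIntegral.integral_congr fun σ _ => ?_
      simp only [kernelDiff, inner_line_eq ε _ he ht het, inner_add_left, real_inner_smul_left]
      module
    all_goals exact Continuous.intervalIntegrable (by fun_prop) _ _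
  have hA := abs_integral_idCoeff_add_log_le hE hd
  have hB := abs_integral_dyadCoeff_le hE hd
  have hC := abs_integral_dyadCoeff_mul_sq_add_log_le hE hd
  rw [integral_dyadCoeff_mul_id, zero_smul, add_zero] at hsplit
  rw [hsplit]
  generalize (∫ σ in (-(1 / 2) : ℝ)..1 / 2, idCoeff (ε ^ 2) d (σ ^ 2 + ε ^ 2)) = a at *
  generalize (∫ σ in (-(1 / 2) : ℝ)..1 / 2, dyadCoeff (ε ^ 2) d (σ ^ 2 + ε ^ 2)) = b at *
  generalize (∫ σ in (-(1 / 2) : ℝ)..1 / 2,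
    dyadCoeff (ε ^ 2) d (σ ^ 2 + ε ^ 2) * σ ^ 2) = c at *
  have e1 : a • v + b • (ε ^ 2 * ⟪e, v⟫) • e + c • ⟪t, v⟫ • t
        + Real.log (1 + d / ε ^ 2) • (v + ⟪t, v⟫ • t)
      = (a + Real.log (1 + d / ε ^ 2)) • v + (b * ε ^ 2) • ⟪e, v⟫ • e
        + (c + Real.log (1 + d / ε ^ 2)) • ⟪t, v⟫ • t := by module
  have hunit : ∀ u : V3, ‖u‖ = 1 → ‖⟪u, v⟫ • u‖ ≤ ‖v‖ := fun u hu => by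
    rw [norm_smul, hu, mul_one]
    simpa [hu] using norm_inner_le_norm (𝕜 := ℝ) u v
  rw [e1]
  refine (norm_add₃_le).trans ?_
  rw [norm_smul (a + _), norm_smul (b * _), norm_smul (c + _), norm_mul, Real.norm_eq_abs,
    Real.norm_eq_abs,
    Real.norm_eq_abs, Real.norm_eq_abs, abs_of_pos hE]
  calc _ ≤ 8 * d * ‖v‖ + 4 * ε ^ 2 * ‖v‖ + 12 * d * ‖v‖ := by
        gcongr
        · exact hunit e he
        · exact hunit t ht
    _ ≤ _ := by nlinarith [mul_nonneg hE.le (norm_nonneg v)]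

theorem Function.Periodic.deriv_periodic {f : ℝ → V3} {T : ℝ} (hf : Function.Periodic f T) :
    Function.Periodic (deriv f) T := fun s => by
  rw [← deriv_comp_add_const, funext hf]

theorem norm_le_C0norm {f : ℝ → V3} (hf : Continuous f) (hp : Function.Periodic f 1) (s : ℝ) :
    ‖f s‖ ≤ C0norm f := by
  refine le_ciSup (f := fun s => ‖f s‖) ?_ s
  have h := (hp.compact_of_continuous one_ne_zero hf).isBounded
  obtain ⟨M, hM⟩ := h.exists_norm_le
  exact ⟨M, by rintro _ ⟨t, rfl⟩; exact hM _ ⟨t, rfl⟩⟩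

theorem norm_le_C1norm {f : ℝ → V3} (hf : ContDiff ℝ 1 f) (hp : Function.Periodic f 1) (s : ℝ) :
    ‖f s‖ ≤ C1norm f :=
  (norm_le_C0norm hf.continuous hp s).trans
    (le_add_of_nonneg_right (Real.iSup_nonneg fun _ => norm_nonneg _))

theorem norm_sub_le_C1norm_mul {f : ℝ → V3} (hf : ContDiff ℝ 1 f) (hp : Function.Periodic f 1)
    (s t : ℝ) : ‖f t - f s‖ ≤ C1norm f * |t - s| :=
  convex_univ.norm_image_sub_le_of_norm_deriv_le
    (fun x _ => (hf.differentiable (by norm_num)).differentiableAt)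
    (fun x _ => (norm_le_C0norm (hf.continuous_deriv le_rfl) hp.deriv_periodic x).trans
      (le_add_of_nonneg_left (Real.iSup_nonneg fun _ => norm_nonneg _)))
    (Set.mem_univ s) (Set.mem_univ t)

namespace SlenderGeom

variable {cΓ κmax : ℝ} {X en1 en2 : ℝ → V3}

theorem differentiable (hG : SlenderGeom cΓ κmax X en1 en2) : Differentiable ℝ X :=
  hG.smooth.differentiable (by norm_num)

theorem norm_centerline_sub_le (hG : SlenderGeom cΓ κmax X en1 en2) (s t : ℝ) : ‖X s - X t‖ ≤ |s - t| := by
  have := convex_univ.norm_image_sub_le_of_norm_deriv_le (C := 1)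
    (fun x _ => hG.differentiable.differentiableAt (x := x))
    (fun x _ => (hG.arclength x).le) (Set.mem_univ t) (Set.mem_univ s)
  rwa [one_mul] at this

theorem norm_deriv_sub_le (hG : SlenderGeom cΓ κmax X en1 en2) (s t : ℝ) :
    ‖deriv X s - deriv X t‖ ≤ κmax * |s - t| := by
  have h2 : ContDiff ℝ 1 (deriv X) := by
    have := hG.smooth
    rw [show (2 : WithTop ℕ∞) = 1 + 1 by norm_num, contDiff_succ_iff_deriv] at this
    exact this.2.2
  exact convex_univ.norm_image_sub_le_of_norm_deriv_le
    (fun x _ => (h2.differentiable (by norm_num)).differentiableAt)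
    (fun x _ => hG.curvature_max x) (Set.mem_univ t) (Set.mem_univ s)

theorem norm_sub_sub_smul_le (hG : SlenderGeom cΓ κmax X en1 en2) (s σ : ℝ) :
    ‖X s - X (s - σ) - σ • deriv X s‖ ≤ κmax * σ ^ 2 := by
  have hκ : 0 ≤ κmax := (norm_nonneg _).trans (hG.curvature_max s)
  have hd : ∀ τ, HasDerivAt (fun τ => X τ - τ • deriv X s) (deriv X τ - deriv X s) τ := fun τ => by
    have h1 := (hG.differentiable τ).hasDerivAt
    have h2 := (hasDerivAt_id τ).smul_const (deriv X s)
    rw [one_smul] at h2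
    exact h1.sub h2
  have h := (convex_uIcc (s - σ) s).norm_image_sub_le_of_norm_hasDerivWithin_le
    (f := fun τ => X τ - τ • deriv X s) (C := κmax * |σ|)
    (fun τ _ => (hd τ).hasDerivWithinAt)
    (fun τ hτ => (hG.norm_deriv_sub_le τ s).trans ?_) Set.left_mem_uIcc Set.right_mem_uIcc
  · have e : X s - X (s - σ) - σ • deriv X s
        = X s - s • deriv X s - (X (s - σ) - (s - σ) • deriv X s) := by module
    rw [e]
    refine h.trans (le_of_eq ?_)
    rw [Real.norm_eq_abs, sub_sub_cancel, mul_assoc, abs_mul_abs_self, sq]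
  · refine mul_le_mul_of_nonneg_left ?_ hκ
    have := Set.abs_sub_right_of_mem_uIcc hτ
    rwa [sub_sub_cancel, abs_sub_comm] at this

theorem norm_ePerp (hG : SlenderGeom cΓ κmax X en1 en2) (s θ : ℝ) :
    ‖ePerp en1 en2 s θ‖ = 1 := by
  have h : ‖ePerp en1 en2 s θ‖ ^ 2 = 1 := by
    rw [ePerp, norm_add_sq_real, norm_smul, norm_smul, real_inner_smul_left,
      real_inner_smul_right, hG.en1_en2, hG.en1_unit, hG.en2_unit]
    simp only [Real.norm_eq_abs, mul_one, sq_abs, mul_zero, add_zero]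
    exact Real.cos_sq_add_sin_sq θ
  exact (pow_eq_one_iff_of_nonneg (norm_nonneg _) two_ne_zero).1 h

theorem inner_deriv_ePerp (hG : SlenderGeom cΓ κmax X en1 en2) (s θ : ℝ) :
    ⟪deriv X s, ePerp en1 en2 s θ⟫ = 0 := by
  rw [ePerp, inner_add_right, real_inner_smul_right, real_inner_smul_right, hG.es_en1, hG.es_en2]
  ring

/-- Points near the curve at distance `ε` from the centerline are quantitatively separated from
the rest of the centerline. -/
theorem le_norm_surface_sub (hG : SlenderGeom cΓ κmax X en1 en2) (hcΓ : 0 < cΓ) {κ ε : ℝ}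
    (hκ : 0 < κ) (hκmax : κmax ≤ κ) (hε : 0 < ε) (hε1 : ε ≤ 1 / (2 * κ)) (hε2 : ε ≤ cΓ / (4 * κ))
    {e : V3} {s σ : ℝ} (he : ‖e‖ = 1) (het : ⟪deriv X s, e⟫ = 0) (hσ : |σ| ≤ 1 / 2) :
    min (1 / 2) (cΓ / 4) * √(σ ^ 2 + ε ^ 2) ≤ ‖X s + ε • e - X (s - σ)‖ := by
  set r := √(σ ^ 2 + ε ^ 2) with hr
  have hr0 : 0 ≤ r := Real.sqrt_nonneg _
  have hσr : |σ| ≤ r := Real.abs_le_sqrt (by nlinarith)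
  rcases le_or_gt |σ| (1 / (2 * κ)) with h | h
  · have h0 : ‖ε • e + σ • deriv X s‖ = r := by
      rw [hr, ← inner_line_eq ε σ he (hG.arclength s) het, Real.sqrt_sq (norm_nonneg _)]
    have h1 := hG.norm_sub_sub_smul_le s σ
    have h2 : κmax * σ ^ 2 ≤ r / 2 := by
      have : |σ| * κ ≤ 1 / 2 := by
        rw [le_div_iff₀ (by positivity)] at h
        linarith
      calc κmax * σ ^ 2 ≤ κ * σ ^ 2 := by gcongr
        _ = (|σ| * κ) * |σ| := by rw [← sq_abs]; ring
        _ ≤ 1 / 2 * r := by gcongr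
        _ = r / 2 := by ring
    have h3 : ε • e + σ • deriv X s = (X s + ε • e - X (s - σ))
        - (X s - X (s - σ) - σ • deriv X s) := by module
    have h4 := norm_sub_le (X s + ε • e - X (s - σ)) (X s - X (s - σ) - σ • deriv X s)
    rw [← h3, h0] at h4
    have h5 : min (1 / 2) (cΓ / 4) * r ≤ 1 / 2 * r := by gcongr; exact min_le_left _ _
    linarith
  · have h1 := hG.no_self_intersect s (s - σ) (by rwa [sub_sub_cancel])
    rw [sub_sub_cancel] at h1
    have hεσ : ε ≤ |σ| := hε1.trans h.le
    have h2 : ε ≤ cΓ / 2 * |σ| := by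
      calc ε ≤ cΓ / (4 * κ) := hε2
        _ = cΓ / 2 * (1 / (2 * κ)) := by field_simp; norm_num
        _ ≤ _ := by gcongr
    have h3 : r ≤ 2 * |σ| := by
      rw [hr, Real.sqrt_le_left (by positivity), mul_pow, sq_abs]
      have : ε ^ 2 ≤ |σ| ^ 2 := by gcongr
      rw [sq_abs] at this
      nlinarith
    have h4 : ‖X s - X (s - σ)‖ ≤ ‖X s + ε • e - X (s - σ)‖ + ε := by
      have e1 : X s - X (s - σ) = (X s + ε • e - X (s - σ)) - ε • e := by module
      have := norm_sub_le (X s + ε • e - X (s - σ)) (ε • e)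
      rwa [← e1, norm_smul, he, mul_one, Real.norm_eq_abs, abs_of_pos hε] at this
    have h5 : min (1 / 2) (cΓ / 4) * r ≤ cΓ / 4 * (2 * |σ|) := by
      gcongr
      exact min_le_right _ _
    linarith

end SlenderGeom

theorem integral_sq_div_sq_add_sq_le {η : ℝ} (hη : 0 < η) :
    ∫ σ in (-(1 / 2) : ℝ)..1 / 2, η ^ 2 / (σ ^ 2 + η ^ 2) ≤ Real.pi * η := by
  have hd : ∀ σ : ℝ, HasDerivAt (fun σ => η * Real.arctan (σ / η)) (η ^ 2 / (σ ^ 2 + η ^ 2)) σ :=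
    fun σ => by
      refine ((((hasDerivAt_id σ).div_const η).arctan).const_mul η).congr_deriv ?_
      simp only [id]
      field_simp
      ring
  have hc : Continuous fun σ : ℝ => η ^ 2 / (σ ^ 2 + η ^ 2) :=
    continuous_const.div (by fun_prop) (fun σ => by positivity)
  rw [intervalIntegral.integral_eq_sub_of_hasDerivAt (fun σ _ => hd σ)
    (hc.intervalIntegrable _ _)]
  have h1 := Real.arctan_lt_pi_div_two (1 / 2 / η)
  have h2 := Real.neg_pi_div_two_lt_arctan (-(1 / 2) / η)
  nlinarith

theorem integral_unit_eq_integral_centered {h : ℝ → V3} (hp : Function.Periodic h 1) (s : ℝ) :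
    ∫ t in (0 : ℝ)..1, h t = ∫ σ in (-(1 / 2) : ℝ)..1 / 2, h (s - σ) := by
  rw [intervalIntegral.integral_comp_sub_left]
  have := hp.intervalIntegral_add_eq 0 (s - 1 / 2)
  rw [zero_add] at this
  rw [this]
  congr 1
  ring

theorem one_le_abs_log {x : ℝ} (hx : 0 < x) (hx1 : x ≤ 1 / 3) : 1 ≤ |Real.log x| := by
  have h : Real.log x ≤ -1 := by
    rw [Real.log_le_iff_le_exp hx, Real.exp_neg]
    refine hx1.trans ?_
    rw [one_div]
    exact inv_anti₀ (Real.exp_pos 1) (by linarith [Real.exp_one_lt_d9])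
  rw [abs_of_neg (by linarith)]
  linarith

theorem continuousOn_classical_kernel {s : Set ℝ} {y v : ℝ → V3} (hy : ContinuousOn y s)
    (hv : ContinuousOn v s) (h0 : ∀ σ ∈ s, y σ ≠ 0) (b : ℝ) :
    ContinuousOn (fun σ => stokeslet (y σ) (v σ) + b • doubletK (y σ) (v σ)) s := by
  have hinv : ∀ n : ℕ, ContinuousOn (fun σ => (‖y σ‖ ^ n)⁻¹) s := fun n =>
    (hy.norm.pow n).inv₀ (fun σ hσ => pow_ne_zero n (norm_ne_zero_iff.2 (h0 σ hσ)))
  have h1 := hinv 1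
  have h3 := hinv 3
  have h5 := hinv 5
  simp only [pow_one] at h1
  have hin := hy.inner (𝕜 := ℝ) hv
  exact ((h1.smul hv).add (h3.smul (hin.smul hy))).add
    (((h3.smul hv).sub ((h5.const_mul 3).smul (hin.smul hy))).const_smul b)

theorem continuous_regularized_kernel {δ : ℝ} (hδ : 0 < δ) {y v : ℝ → V3} (hy : Continuous y)
    (hv : Continuous v) (b : ℝ) :
    Continuous (fun σ => stokesletReg δ (y σ) (v σ) + b • doubletReg δ (y σ) (v σ)) := by
  have hpos : ∀ σ, 0 < ‖y σ‖ ^ 2 + δ ^ 2 := fun σ => by positivity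
  have hinv : ∀ p : ℝ, Continuous (fun σ => ((‖y σ‖ ^ 2 + δ ^ 2) ^ p)⁻¹) := fun p =>
    (((hy.norm.pow 2).add continuous_const).rpow_const (fun σ => Or.inl (hpos σ).ne')).inv₀
      (fun σ => (Real.rpow_pos_of_pos (hpos σ) p).ne')
  have hin := hy.inner (𝕜 := ℝ) hv
  have hq := (hin.smul hy).add (hv.const_smul (δ ^ 2))
  exact (((hinv _).smul hv).add ((hinv _).smul hq)).add
    ((((hinv _).smul hv).sub (((hinv _).const_mul 3).smul hq)).const_smul b)

theorem uReg_sub_uSB_eq {X f : ℝ → V3} (hX : Continuous X) (hXp : Function.Periodic X 1)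
    (hf : Continuous f) (hfp : Function.Periodic f 1) {ε δ : ℝ} (hδ : 0 < δ) (s : ℝ) {x : V3}
    (hx : ∀ σ : ℝ, |σ| ≤ 1 / 2 → x - X (s - σ) ≠ 0) :
    IntervalIntegrable (fun σ => kernelDiff (ε ^ 2) (δ ^ 2) (x - X (s - σ)) (f (s - σ))) volume
        (-(1 / 2)) (1 / 2) ∧
      (8 * Real.pi) • (uReg X f ((ε ^ 2 + δ ^ 2) / 2) δ x - uSB X f ε x)
        = ∫ σ in (-(1 / 2) : ℝ)..1 / 2,
            kernelDiff (ε ^ 2) (δ ^ 2) (x - X (s - σ)) (f (s - σ)) := by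
  have hmem : ∀ σ ∈ Set.uIcc (-(1 / 2) : ℝ) (1 / 2), |σ| ≤ 1 / 2 := fun σ hσ => by
    rw [Set.uIcc_of_le (by norm_num)] at hσ
    exact abs_le.2 hσ
  have hy : Continuous fun σ => x - X (s - σ) := by fun_prop
  have hv : Continuous fun σ => f (s - σ) := by fun_prop
  have hr := (continuous_regularized_kernel hδ hy hv ((ε ^ 2 + δ ^ 2) / 2)).intervalIntegrable
    (μ := volume) (-(1 / 2)) (1 / 2)
  have hc := (continuousOn_classical_kernel hy.continuousOn hv.continuousOn
    (fun σ hσ => hx σ (hmem σ hσ)) (ε ^ 2 / 2)).intervalIntegrable (μ := volume)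
  have heq : Set.EqOn
      (fun σ => kernelDiff (ε ^ 2) (δ ^ 2) (x - X (s - σ)) (f (s - σ)))
      (fun σ => (stokesletReg δ (x - X (s - σ)) (f (s - σ))
          + ((ε ^ 2 + δ ^ 2) / 2) • doubletReg δ (x - X (s - σ)) (f (s - σ)))
        - (stokeslet (x - X (s - σ)) (f (s - σ))
          + (ε ^ 2 / 2) • doubletK (x - X (s - σ)) (f (s - σ))))
      (Set.uIcc (-(1 / 2)) (1 / 2)) := fun σ hσ =>
    (reg_sub_classical_eq_kernelDiff (hx σ (hmem σ hσ)) _).symm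
  constructor
  · exact (hr.sub hc).congr (fun σ hσ => (heq (Set.uIoc_subset_uIcc hσ)).symm)
  · have hpi : 8 * Real.pi ≠ 0 := by positivity
    rw [intervalIntegral.integral_congr heq, intervalIntegral.integral_sub hr hc, uReg, uSB,
      ← smul_sub, smul_inv_smul₀ hpi,
      integral_unit_eq_integral_centered (s := s) (fun t => by rw [hXp, hfp]),
      integral_unit_eq_integral_centered (s := s) (fun t => by rw [hXp, hfp])]

theorem weight_bounds {c ε d σ : ℝ} (hc : 0 < c) (hc1 : c ≤ 1) (hε : 0 < ε) (hd : 0 < d) :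
    ε ^ 2 ≤ (c⁻¹ ^ 2 * ((ε ^ 2 + d) / (σ ^ 2 + (ε ^ 2 + d)))) * (c * √(σ ^ 2 + ε ^ 2)) ^ 2 ∧
      ε ^ 2 + d ≤ (c⁻¹ ^ 2 * ((ε ^ 2 + d) / (σ ^ 2 + (ε ^ 2 + d))))
        * ((c * √(σ ^ 2 + ε ^ 2)) ^ 2 + d) := by
  rw [mul_pow, sq_sqrt_sq_add (by positivity)]
  have hpos : 0 < σ ^ 2 + (ε ^ 2 + d) := by positivity
  have hc2 : c ^ 2 ≤ 1 := pow_le_one₀ hc.le hc1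
  constructor
  · have e : (c⁻¹ ^ 2 * ((ε ^ 2 + d) / (σ ^ 2 + (ε ^ 2 + d)))) * (c ^ 2 * (σ ^ 2 + ε ^ 2))
        = (ε ^ 2 + d) * (σ ^ 2 + ε ^ 2) / (σ ^ 2 + (ε ^ 2 + d)) := by field_simp
    rw [e, le_div_iff₀ hpos]
    nlinarith [mul_nonneg hd.le (sq_nonneg σ)]
  · calc ε ^ 2 + d = (c⁻¹ ^ 2 * ((ε ^ 2 + d) / (σ ^ 2 + (ε ^ 2 + d))))
          * (c ^ 2 * (σ ^ 2 + (ε ^ 2 + d))) := by field_simp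
      _ ≤ _ := by
        gcongr
        nlinarith

theorem surface_discrepancy_le {cΓ κmax : ℝ} {X en1 en2 : ℝ → V3}
    (hG : SlenderGeom cΓ κmax X en1 en2) (hcΓ : 0 < cΓ) {κ ε δ : ℝ} (hκ : 0 < κ)
    (hκmax : κmax ≤ κ) (hε : 0 < ε) (hε1 : ε ≤ 1 / (2 * κ)) (hε2 : ε ≤ cΓ / (4 * κ)) (hδ : 0 < δ)
    (hη : ε ^ 2 + δ ^ 2 ≤ 1) {f : ℝ → V3} (hf : ContDiff ℝ 1 f) (hfp : Function.Periodic f 1)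
    (s : ℝ) {e : V3} (he : ‖e‖ = 1) (het : ⟪deriv X s, e⟫ = 0) :
    ‖(8 * Real.pi) • (uReg X f ((ε ^ 2 + δ ^ 2) / 2) δ (X s + ε • e) - uSB X f ε (X s + ε • e))
        + Real.log (1 + δ ^ 2 / ε ^ 2) • (f s + ⟪deriv X s, f s⟫ • deriv X s)‖
      ≤ (kernelConst (min (1 / 2) (cΓ / 4)) κ * (min (1 / 2) (cΓ / 4))⁻¹ ^ 2 * Real.pi + 20)
        * √(ε ^ 2 + δ ^ 2) * C1norm f := by
  set c := min (1 / 2) (cΓ / 4) with hc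
  have hc0 : 0 < c := lt_min (by norm_num) (by positivity)
  have hc1 : c ≤ 1 := (min_le_left _ _).trans (by norm_num)
  set η := √(ε ^ 2 + δ ^ 2) with hηdef
  have hη0 : 0 < η := Real.sqrt_pos.2 (by positivity)
  have hη2 : η ^ 2 = ε ^ 2 + δ ^ 2 := Real.sq_sqrt (by positivity)
  have hη1 : η ≤ 1 := (Real.sqrt_le_left zero_le_one).2 (by linarith)
  have hδ2 : 0 < δ ^ 2 := by positivity
  set F := C1norm f with hF
  have hfF := norm_le_C1norm hf hfp
  have hF0 : 0 ≤ F := (norm_nonneg _).trans (hfF s)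
  have hK : 0 ≤ kernelConst c κ := by rw [kernelConst]; positivity
  have hlow : ∀ σ : ℝ, |σ| ≤ 1 / 2 → c * √(σ ^ 2 + ε ^ 2) ≤ ‖X s + ε • e - X (s - σ)‖ :=
    fun σ hσ => hG.le_norm_surface_sub hcΓ hκ hκmax hε hε1 hε2 he het hσ
  have hrpos : ∀ σ : ℝ, 0 < √(σ ^ 2 + ε ^ 2) := sqrt_sq_add_pos (by positivity)
  obtain ⟨hKint, heq⟩ := uReg_sub_uSB_eq (ε := ε) (x := X s + ε • e) hG.smooth.continuous
    hG.periodicX hf.continuous hfp hδ s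
    (fun σ hσ => norm_pos_iff.1 ((mul_pos hc0 (hrpos σ)).trans_le (hlow σ hσ)))
  have hline := continuous_kernelDiff_line hε hδ2.le he (hG.arclength s) het (f s)
  have hmain := norm_integral_kernelDiff_line_add_log_le hε hδ2 he (hG.arclength s) het (f s)
  have hpt : ∀ σ : ℝ, |σ| ≤ 1 / 2 →
      ‖kernelDiff (ε ^ 2) (δ ^ 2) (X s + ε • e - X (s - σ)) (f (s - σ))
          - kernelDiff (ε ^ 2) (δ ^ 2) (ε • e + σ • deriv X s) (f s)‖
        ≤ kernelConst c κ * c⁻¹ ^ 2 * F * (η ^ 2 / (σ ^ 2 + η ^ 2)) := fun σ hσ => by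
    have hσr : |σ| ≤ √(σ ^ 2 + ε ^ 2) := Real.abs_le_sqrt (by nlinarith)
    have hεr : ε ≤ √(σ ^ 2 + ε ^ 2) := Real.le_sqrt_of_sq_le (by nlinarith)
    have hn₀ : ‖ε • e + σ • deriv X s‖ = √(σ ^ 2 + ε ^ 2) := by
      rw [← inner_line_eq ε σ he (hG.arclength s) het, Real.sqrt_sq (norm_nonneg _)]
    obtain ⟨hw1, hw2⟩ := weight_bounds (σ := σ) hc0 hc1 hε hδ2
    refine (norm_kernelDiff_sub_le (by positivity) hδ2.le hc0 (hrpos σ) hκ.le hw1 hw2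
      (hlow σ hσ) ?_ ?_ ?_ ?_ ?_ (hfF s)).trans (le_of_eq ?_)
    · rw [hn₀]
      exact mul_le_of_le_one_left (hrpos σ).le hc1
    · have e1 : X s + ε • e - X (s - σ) = ε • e + (X s - X (s - σ)) := by module
      have h1 := hG.norm_centerline_sub_le s (s - σ)
      rw [sub_sub_cancel] at h1
      have h2 : ‖ε • e‖ = ε := by rw [norm_smul, he, mul_one, Real.norm_of_nonneg hε.le]
      rw [e1]
      linarith [norm_add_le (ε • e) (X s - X (s - σ))]
    · rw [hn₀]
      linarith [hrpos σ]
    · have e1 : X s + ε • e - X (s - σ) - (ε • e + σ • deriv X s)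
          = X s - X (s - σ) - σ • deriv X s := by module
      rw [e1]
      refine (hG.norm_sub_sub_smul_le s σ).trans ?_
      have : σ ^ 2 ≤ √(σ ^ 2 + ε ^ 2) ^ 2 := sq_le_sq' (by linarith [neg_abs_le σ])
        ((le_abs_self σ).trans hσr)
      gcongr
    · refine (norm_sub_le_C1norm_mul hf hfp s (s - σ)).trans ?_
      rw [sub_sub_cancel_left, abs_neg]
      gcongr
    · rw [hη2]
      ring
  have hdiff : ‖(∫ σ in (-(1 / 2) : ℝ)..1 / 2,
          kernelDiff (ε ^ 2) (δ ^ 2) (X s + ε • e - X (s - σ)) (f (s - σ)))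
        - ∫ σ in (-(1 / 2) : ℝ)..1 / 2,
          kernelDiff (ε ^ 2) (δ ^ 2) (ε • e + σ • deriv X s) (f s)‖
      ≤ kernelConst c κ * c⁻¹ ^ 2 * F * (Real.pi * η) := by
    rw [← intervalIntegral.integral_sub hKint (hline.intervalIntegrable _ _)]
    have hcont : Continuous fun σ : ℝ => η ^ 2 / (σ ^ 2 + η ^ 2) :=
      continuous_const.div (by fun_prop) (fun σ => by positivity)
    refine (intervalIntegral.norm_integral_le_of_norm_le (by norm_num)
      (Filter.Eventually.of_forall fun σ hσ => hpt σ (abs_le.2 ⟨hσ.1.le, hσ.2⟩))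
      ((hcont.const_mul _).intervalIntegrable _ _)).trans ?_
    rw [intervalIntegral.integral_const_mul]
    exact mul_le_mul_of_nonneg_left (integral_sq_div_sq_add_sq_le hη0) (by positivity)
  rw [heq]
  have htri : ∀ a b w : V3, ‖a + w‖ ≤ ‖a - b‖ + ‖b + w‖ := fun a b w => by
    have := norm_add_le (a - b) (b + w)
    rwa [show a - b + (b + w) = a + w by abel] at this
  refine (htri _ _ _).trans ((add_le_add hdiff hmain).trans ?_)
  have h20 : 20 * (ε ^ 2 + δ ^ 2) * ‖f s‖ ≤ 20 * η * F := by
    rw [← hη2]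
    gcongr
    · nlinarith
    · exact hfF s
  linarith

/-- At the surface `x = X(s) + ε e_ρ(s,θ)` of the slender body, the
regularized and classical slender-body velocities differ by the `O(1)` term
`log(1 + δ²/ε²)(I + e_s e_sᵀ) f(s)`, with error `C √(ε²+δ²) |log(ε²+δ²)| ‖f‖_{C¹}`. -/
theorem surface_log_discrepancy (cΓ κmax : ℝ) (hcΓ : 0 < cΓ) :
    ∃ C > 0, ∃ ε₀ > 0,
      ∀ X en1 en2 : ℝ → V3, SlenderGeom cΓ κmax X en1 en2 →
      ∀ ε δ : ℝ, 0 < ε → ε < ε₀ → 0 < δ → δ < ε₀ →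
      ∀ f : ℝ → V3, ContDiff ℝ 1 f → (∀ s, f (s + 1) = f s) →
      ∀ s θ : ℝ,
        ‖(8 * Real.pi) • (uReg X f ((ε ^ 2 + δ ^ 2) / 2) δ (X s + ε • ePerp en1 en2 s θ)
              - uSB X f ε (X s + ε • ePerp en1 en2 s θ))
            + Real.log (1 + δ ^ 2 / ε ^ 2) • (f s + ⟪deriv X s, f s⟫ • deriv X s)‖
          ≤ C * Real.sqrt (ε ^ 2 + δ ^ 2) * |Real.log (ε ^ 2 + δ ^ 2)| * C1norm f := by
  set κ := max κmax 1 with hκdef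
  have hκ : 0 < κ := zero_lt_one.trans_le (le_max_right _ _)
  set C := kernelConst (min (1 / 2) (cΓ / 4)) κ * (min (1 / 2) (cΓ / 4))⁻¹ ^ 2 * Real.pi + 20
    with hC
  have hc0 : 0 < min (1 / 2) (cΓ / 4) := lt_min (by norm_num) (by positivity)
  have hC0 : 0 < C := by rw [hC, kernelConst]; positivity
  refine ⟨C, hC0, min (1 / 4) (min (1 / (2 * κ)) (cΓ / (4 * κ))),
    lt_min (by norm_num) (lt_min (by positivity) (by positivity)), ?_⟩
  intro X en1 en2 hG ε δ hε hε₀ hδ hδ₀ f hf hfp s θ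
  have hε4 := hε₀.trans_le (min_le_left _ _)
  have hδ4 := hδ₀.trans_le (min_le_left _ _)
  have hε' := hε₀.trans_le (min_le_right _ _)
  have hη : ε ^ 2 + δ ^ 2 ≤ 1 / 3 := by nlinarith
  have hlog := one_le_abs_log (by positivity) hη
  have hF0 : 0 ≤ C1norm f := (norm_nonneg _).trans (norm_le_C1norm hf hfp s)
  refine (surface_discrepancy_le hG hcΓ hκ (le_max_left _ _) hε
    (hε'.trans_le (min_le_left _ _)).le (hε'.trans_le (min_le_right _ _)).le hδ (by linarith)
    hf hfp s (hG.norm_ePerp s θ) (hG.inner_deriv_ePerp s θ)).trans ?_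
  exact mul_le_mul_of_nonneg_right (le_mul_of_one_le_right (by positivity) hlog) hF0
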